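/- arXiv:1312.3873 — 2 statements merged into one kernel-verified Lean document; each statement's English description precedes it below -/
import Mathlib

section
/- For every f ∈ K(B, ℍ) there exists a continuous function h : S³ → ℍ such that f(z) = ∫_{S³} h(ξ)·(σ*_z P(z, ξ)) ψ(dξ) for every z ∈ B, where σ*_z P(z, ξ) denotes the adjoint Dirac operator applied to the Poisson kernel P(z, ξ) in the variable z. -/
open MeasureTheory Metric
open scoped Quaternion

noncomputable instance : MeasurableSpace ℍ[ℝ] := borel _
instance : BorelSpace ℍ[ℝ] := ⟨rfl⟩

/-- The standard basis `1, i₁, i₂, i₃` of the quaternions over ℝ. -/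
noncomputable def qe : Fin 4 → ℍ[ℝ]
  | 0 => ⟨1, 0, 0, 0⟩
  | 1 => ⟨0, 1, 0, 0⟩
  | 2 => ⟨0, 0, 1, 0⟩
  | 3 => ⟨0, 0, 0, 1⟩

/-- The Dirac operator `σf(z) = ∑ⱼ (∂f/∂zⱼ)(z)·iⱼ` (with `i₀ = 1`), where `∂/∂zⱼ` is
the partial derivative in the `j`-th real coordinate direction of `ℍ ≅ ℝ⁴`. -/
noncomputable def Dirac (f : ℍ[ℝ] → ℍ[ℝ]) (z : ℍ[ℝ]) : ℍ[ℝ] :=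
  ∑ j : Fin 4, fderiv ℝ f z (qe j) * qe j

/-- The adjoint Dirac operator `σ*f(z) = ∑ⱼ (∂f/∂zⱼ)(z)·iⱼ*`. -/
noncomputable def DiracStar (f : ℍ[ℝ] → ℍ[ℝ]) (z : ℍ[ℝ]) : ℍ[ℝ] :=
  ∑ j : Fin 4, fderiv ℝ f z (qe j) * star (qe j)

/-- The Laplace operator `Δf(z) = ∑ⱼ ∂²f/∂zⱼ²(z)` in the four real coordinates of `ℍ ≅ ℝ⁴`. -/
noncomputable def qLap (f : ℍ[ℝ] → ℍ[ℝ]) (z : ℍ[ℝ]) : ℍ[ℝ] :=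
  ∑ j : Fin 4, fderiv ℝ (fun w => fderiv ℝ f w (qe j)) z (qe j)

/-- The Poisson kernel `P(z, ξ) = (1 − |z|²)/|z − ξ|⁴` of the unit ball of `ℍ ≅ ℝ⁴`. -/
noncomputable def pker (z ξ : ℍ[ℝ]) : ℝ := (1 - ‖z‖ ^ 2) / ‖z - ξ‖ ^ 4

/-- The adjoint Dirac operator applied to the Poisson kernel in the variable `z`. -/
noncomputable def dstarP (ξ z : ℍ[ℝ]) : ℍ[ℝ] :=
  DiracStar (fun w => ((pker w ξ : ℝ) : ℍ[ℝ])) z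

/-- Membership in the Dirac module `K(B, ℍ)`: continuous on `B̄`, continuously
ℝ-differentiable on `B`, annihilated by the Dirac operator on `B`. -/
def memK (f : ℍ[ℝ] → ℍ[ℝ]) : Prop :=
  ContinuousOn f (closedBall 0 1) ∧ ContDiffOn ℝ 1 f (ball 0 1) ∧
    ∀ z ∈ ball (0 : ℍ[ℝ]) 1, Dirac f z = 0

open Filter Topology

section General

variable {F : Type*} [NormedAddCommGroup F] [NormedSpace ℝ F]

theorem HasLineDerivAt.hasDerivAt_line {E : Type*} [AddCommGroup E] [Module ℝ E]
    {u : E → F} {u' : F} {z e : E} {t : ℝ} (h : HasLineDerivAt ℝ u u' (z + t • e) e) :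
    HasDerivAt (fun s : ℝ => u (z + s • e)) u' t := by
  have h' : HasDerivAt (fun s : ℝ => u (z + t • e + s • e)) u' (t - t) := by
    rw [sub_self]; exact h
  refine (h'.comp_sub_const t t).congr_of_eventuallyEq (Eventually.of_forall fun s => ?_)
  simp only
  rw [sub_smul]; congr 1; abel

theorem eventually_line_mem {E : Type*} [NormedAddCommGroup E] [NormedSpace ℝ E] {U : Set E}
    (hU : IsOpen U) {z : E} (hz : z ∈ U) (e : E) : ∀ᶠ t : ℝ in 𝓝 0, z + t • e ∈ U := by
  have hc : Continuous fun t : ℝ => z + t • e := by fun_prop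
  exact hc.continuousAt.eventually (hU.mem_nhds (by simpa using hz))

theorem IsLocalMax.second_deriv_nonpos {φ φ' : ℝ → ℝ} {a x : ℝ} (hmax : IsLocalMax φ x)
    (h₁ : ∀ᶠ t in 𝓝 x, HasDerivAt φ (φ' t) t) (h₂ : HasDerivAt φ' a x) : a ≤ 0 := by
  by_contra! ha
  have hd : deriv φ =ᶠ[𝓝 x] φ' := h₁.mono fun t ht => ht.deriv
  have hdd : deriv (deriv φ) x = a := by rw [hd.deriv_eq, h₂.deriv]
  have hmin : IsLocalMin φ x := isLocalMin_of_deriv_deriv_pos (by rwa [hdd])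
    hmax.deriv_eq_zero h₁.self_of_nhds.continuousAt
  have hconst : φ =ᶠ[𝓝 x] fun _ => φ x := by
    filter_upwards [hmax, hmin] with t h h' using le_antisymm h h'
  have : deriv (deriv φ) x = 0 := by
    rw [hconst.deriv.deriv_eq]; simp
  linarith

variable {X Y : Type*} [TopologicalSpace Y] [MeasurableSpace Y] [OpensMeasurableSpace Y]

theorem continuousOn_integral_of_isCompact [TopologicalSpace X] [FirstCountableTopology X]
    [TopologicalSpace.PseudoMetrizableSpace Y] [T2Space Y]
    {μ : Measure Y} [IsFiniteMeasure μ] {U : Set X} {S : Set Y} (hU : IsCompact U)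
    (hS : IsCompact S) {K : X → Y → F} (hK : ContinuousOn (Function.uncurry K) (U ×ˢ S)) :
    ContinuousOn (fun x => ∫ y in S, K x y ∂μ) U := by
  obtain ⟨C, hC⟩ := (hU.prod hS).exists_bound_of_continuousOn hK
  refine continuousOn_of_dominated (bound := fun _ => C) (fun x hx => ?_) (fun x hx => ?_)
    (integrable_const C) ?_
  · exact (hK.comp (by fun_prop : ContinuousOn (fun y => (x, y)) S)
      fun y hy => ⟨hx, hy⟩).aestronglyMeasurable_of_isCompact hS hS.isClosed.measurableSet
  · exact (ae_restrict_mem hS.isClosed.measurableSet).mono fun y hy => hC (x, y) ⟨hx, hy⟩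
  · exact (ae_restrict_mem hS.isClosed.measurableSet).mono fun y hy =>
      hK.comp (by fun_prop : ContinuousOn (fun x => (x, y)) U) fun x hx => ⟨hx, hy⟩

theorem hasLineDerivAt_integral_of_isCompact [NormedAddCommGroup X] [NormedSpace ℝ X]
    [ProperSpace X] [TopologicalSpace.PseudoMetrizableSpace Y] [T2Space Y]
    {μ : Measure Y} [IsFiniteMeasure μ] {U : Set X} {S : Set Y}
    (hU : IsOpen U) (hS : IsCompact S) {K K' : X → Y → F} {e : X}
    (hK : ContinuousOn (Function.uncurry K) (U ×ˢ S))
    (hK' : ContinuousOn (Function.uncurry K') (U ×ˢ S))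
    (hd : ∀ x ∈ U, ∀ y ∈ S, HasLineDerivAt ℝ (fun x => K x y) (K' x y) x e)
    {x : X} (hx : x ∈ U) :
    HasLineDerivAt ℝ (fun x => ∫ y in S, K x y ∂μ) (∫ y in S, K' x y ∂μ) x e := by
  obtain ⟨r, hr, hrU⟩ := nhds_basis_closedBall.mem_iff.1 (hU.mem_nhds hx)
  obtain ⟨C, hC⟩ := ((isCompact_closedBall x r).prod hS).exists_bound_of_continuousOn
    (hK'.mono (Set.prod_mono hrU subset_rfl))
  have hslice : ∀ {G : X → Y → F}, ContinuousOn (Function.uncurry G) (U ×ˢ S) → ∀ w ∈ U,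
      ContinuousOn (G w) S := fun {G} hG w hw =>
    hG.comp (by fun_prop : ContinuousOn (fun y => (w, y)) S) fun y hy => ⟨hw, hy⟩
  have hnear : ∀ᶠ t : ℝ in 𝓝 0, x + t • e ∈ ball x r :=
    eventually_line_mem isOpen_ball (mem_ball_self hr) e
  have hmS := hS.isClosed.measurableSet
  have key := hasDerivAt_integral_of_dominated_loc_of_deriv_le (μ := μ.restrict S) (𝕜 := ℝ)
    (bound := fun _ => C) (F := fun t y => K (x + t • e) y) (F' := fun t y => K' (x + t • e) y)
    (x₀ := 0) (s := {t | x + t • e ∈ ball x r}) hnear ?_ ?_ ?_ ?_ (integrable_const C) ?_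
  · simpa [HasLineDerivAt] using key.2
  · filter_upwards [hnear] with t ht
    exact (hslice hK _ (hrU (ball_subset_closedBall ht))).aestronglyMeasurable_of_isCompact hS hmS
  · exact (hslice hK _ (by simpa using hx)).integrableOn_compact' hS hmS
  · exact (hslice hK' _ (by simpa using hx)).aestronglyMeasurable_of_isCompact hS hmS
  · exact (ae_restrict_mem hmS).mono fun y hy t ht =>
      hC (_, y) ⟨ball_subset_closedBall ht, hy⟩
  · exact (ae_restrict_mem hmS).mono fun y hy t ht =>
      (hd _ (hrU (ball_subset_closedBall ht)) y hy).hasDerivAt_line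

end General

theorem inner_eq_sum_coords (a b : ℍ[ℝ]) :
    inner ℝ a b = a.re * b.re + a.imI * b.imI + a.imJ * b.imJ + a.imK * b.imK := by
  simp [Quaternion.inner_def]

theorem norm_qe (j : Fin 4) : ‖qe j‖ = 1 := by
  rw [← pow_left_inj₀ (norm_nonneg _) zero_le_one two_ne_zero, ← real_inner_self_eq_norm_sq,
    inner_eq_sum_coords]
  fin_cases j <;> simp [qe]

theorem sum_inner_qe_mul_inner_qe (a b : ℍ[ℝ]) :
    ∑ j, inner ℝ a (qe j) * inner ℝ b (qe j) = inner ℝ a b := by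
  simp [Fin.sum_univ_four, inner_eq_sum_coords, qe]

section Harmonic

variable {F : Type*} [NormedAddCommGroup F] [NormedSpace ℝ F]

/-- Harmonicity on the unit ball, phrased through iterated directional derivatives along the
coordinate axes. -/
def IsLineHarmonic (u : ℍ[ℝ] → F) : Prop :=
  ∃ u₁ u₂ : Fin 4 → ℍ[ℝ] → F, ∀ z ∈ ball (0 : ℍ[ℝ]) 1,
    (∀ j, HasLineDerivAt ℝ u (u₁ j z) z (qe j) ∧ HasLineDerivAt ℝ (u₁ j) (u₂ j z) z (qe j)) ∧
      ∑ j, u₂ j z = 0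

theorem IsLineHarmonic.sub {u v : ℍ[ℝ] → F} (hu : IsLineHarmonic u) (hv : IsLineHarmonic v) :
    IsLineHarmonic (u - v) := by
  obtain ⟨u₁, u₂, hu⟩ := hu
  obtain ⟨v₁, v₂, hv⟩ := hv
  refine ⟨u₁ - v₁, u₂ - v₂, fun z hz => ⟨fun j => ⟨?_, ?_⟩, ?_⟩⟩
  · exact HasDerivAt.sub ((hu z hz).1 j).1 ((hv z hz).1 j).1
  · exact HasDerivAt.sub ((hu z hz).1 j).2 ((hv z hz).1 j).2
  · simp [Finset.sum_sub_distrib, (hu z hz).2, (hv z hz).2]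

theorem isLineHarmonic_const (c : F) : IsLineHarmonic fun _ => c :=
  ⟨fun _ _ => 0, fun _ _ => 0, fun _ _ =>
    ⟨fun _ => ⟨hasDerivAt_const _ _, hasDerivAt_const _ _⟩, by simp⟩⟩

theorem IsLineHarmonic.clm_comp {G : Type*} [NormedAddCommGroup G] [NormedSpace ℝ G]
    {u : ℍ[ℝ] → F} (hu : IsLineHarmonic u) (L : F →L[ℝ] G) :
    IsLineHarmonic fun z => L (u z) := by
  obtain ⟨u₁, u₂, hu⟩ := hu
  refine ⟨fun j z => L (u₁ j z), fun j z => L (u₂ j z), fun z hz => ⟨fun j => ⟨?_, ?_⟩, ?_⟩⟩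
  · exact L.hasFDerivAt.comp_hasDerivAt (0 : ℝ) ((hu z hz).1 j).1
  · exact L.hasFDerivAt.comp_hasDerivAt (0 : ℝ) ((hu z hz).1 j).2
  · simp [← map_sum, (hu z hz).2]

theorem IsLineHarmonic.le_of_sphere_le {u : ℍ[ℝ] → ℝ} (hu : IsLineHarmonic u) {r c : ℝ}
    (hr : r < 1) (hc : ContinuousOn u (closedBall 0 r)) (hs : ∀ z ∈ sphere 0 r, u z ≤ c)
    {z : ℍ[ℝ]} (hz : z ∈ closedBall 0 r) : u z ≤ c := by
  obtain ⟨u₁, u₂, hu⟩ := hu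
  suffices H : ∀ ε > 0, u z ≤ c + ε * r ^ 2 by
    have hlim : Tendsto (fun ε : ℝ => c + ε * r ^ 2) (𝓝[>] 0) (𝓝 c) := by
      have : Continuous fun ε : ℝ => c + ε * r ^ 2 := by fun_prop
      simpa using (this.tendsto 0).mono_left nhdsWithin_le_nhds
    exact ge_of_tendsto hlim (eventually_mem_nhdsWithin.mono fun ε hε => H ε hε)
  intro ε hε
  obtain ⟨m, hm, hmax⟩ := (isCompact_closedBall (0 : ℍ[ℝ]) r).exists_isMaxOn ⟨z, hz⟩
    (f := fun w => u w + ε * ‖w‖ ^ 2) (hc.add (by fun_prop))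
  have hle : u z + ε * ‖z‖ ^ 2 ≤ u m + ε * ‖m‖ ^ 2 := hmax hz
  rcases (mem_closedBall_zero_iff.1 hm).eq_or_lt with h | h
  · have := hs m (by simpa using h)
    rw [h] at hle
    nlinarith [sq_nonneg ‖z‖, mul_nonneg hε.le (sq_nonneg ‖z‖)]
  exfalso
  have hmr : m ∈ ball (0 : ℍ[ℝ]) r := by simpa using h
  have hm1 : m ∈ ball (0 : ℍ[ℝ]) 1 := ball_subset_ball hr.le hmr
  have hj : ∀ j, u₂ j m + 2 * ε ≤ 0 := fun j => by
    have hquad : ∀ t : ℝ, ε * ‖m + t • qe j‖ ^ 2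
        = ε * (‖m‖ ^ 2 + 2 * t * inner ℝ m (qe j) + t ^ 2) := fun t => by
      rw [norm_add_sq_real, norm_smul, norm_qe, inner_smul_right, mul_one, Real.norm_eq_abs, sq_abs]
      ring
    have hloc : IsLocalMax (fun t : ℝ => u (m + t • qe j) + ε * ‖m + t • qe j‖ ^ 2) 0 := by
      filter_upwards [eventually_line_mem isOpen_ball hmr (qe j)] with t ht
      simpa using hmax (ball_subset_closedBall ht)
    refine hloc.second_deriv_nonpos
      (φ' := fun t => u₁ j (m + t • qe j) + ε * (2 * inner ℝ m (qe j) + 2 * t)) ?_ ?_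
    · filter_upwards [eventually_line_mem isOpen_ball hm1 (qe j)] with t ht
      refine ((hu _ ht).1 j).1.hasDerivAt_line.add ?_
      simp only [hquad]
      have h := ((((hasDerivAt_id t).const_mul 2).mul_const (inner ℝ m (qe j))).const_add
        (‖m‖ ^ 2)).add ((hasDerivAt_id t).pow 2)
      refine (h.const_mul ε).congr_deriv ?_
      simp
    · refine HasDerivAt.add ((hu m hm1).1 j).2 ?_
      refine ((((hasDerivAt_id (0 : ℝ)).const_mul 2).const_add
        (2 * inner ℝ m (qe j))).const_mul ε).congr_deriv ?_
      ring
  have hsum := (hu m hm1).2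
  have : ∑ j, (u₂ j m + 2 * ε) ≤ 0 := Finset.sum_nonpos fun j _ => hj j
  rw [Finset.sum_add_distrib, hsum] at this
  simp at this
  linarith

theorem IsLineHarmonic.norm_le_of_sphere_norm_le {F : Type*} [NormedAddCommGroup F]
    [InnerProductSpace ℝ F] {u : ℍ[ℝ] → F} (hu : IsLineHarmonic u) {r c : ℝ} (hr : r < 1)
    (hc : ContinuousOn u (closedBall 0 r)) (hs : ∀ z ∈ sphere 0 r, ‖u z‖ ≤ c)
    {z : ℍ[ℝ]} (hz : z ∈ closedBall 0 r) : ‖u z‖ ≤ c := by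
  rcases eq_or_ne (u z) 0 with h0 | h0
  · have hle : inner ℝ (0 : F) (u z) ≤ c * 0 := by simp
    obtain ⟨w, hw⟩ : (sphere (0 : ℍ[ℝ]) r).Nonempty :=
      NormedSpace.sphere_nonempty.2 (nonempty_closedBall.1 ⟨z, hz⟩)
    rw [h0, norm_zero]
    exact (norm_nonneg _).trans (hs w hw)
  · have h := (hu.clm_comp (innerSL ℝ (u z))).le_of_sphere_le hr (c := ‖u z‖ * c)
      ((innerSL ℝ (u z)).continuous.comp_continuousOn hc)
      (fun w hw => (real_inner_le_norm _ _).trans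
        (mul_le_mul_of_nonneg_left (hs w hw) (norm_nonneg _))) hz
    rw [innerSL_apply_apply, real_inner_self_eq_norm_mul_norm] at h
    exact le_of_mul_le_mul_left h (norm_pos_iff.2 h0)

end Harmonic

section PoissonKernel

/-- The directional derivative of the Poisson kernel along a unit vector `e`. -/
noncomputable def pkerDeriv (e z ξ : ℍ[ℝ]) : ℝ :=
  -2 * inner ℝ z e / ‖z - ξ‖ ^ 4 - 4 * (1 - ‖z‖ ^ 2) * inner ℝ (z - ξ) e / ‖z - ξ‖ ^ 6

/-- The second directional derivative of the Poisson kernel along a unit vector `e`. -/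
noncomputable def pkerDeriv₂ (e z ξ : ℍ[ℝ]) : ℝ :=
  -2 / ‖z - ξ‖ ^ 4 + 16 * (inner ℝ z e * inner ℝ (z - ξ) e) / ‖z - ξ‖ ^ 6
    - 4 * (1 - ‖z‖ ^ 2) / ‖z - ξ‖ ^ 6
    + 24 * (1 - ‖z‖ ^ 2) * (inner ℝ (z - ξ) e * inner ℝ (z - ξ) e) / ‖z - ξ‖ ^ 8

theorem norm_sub_sphere_pos {z ξ : ℍ[ℝ]} (hz : z ∈ ball (0 : ℍ[ℝ]) 1)
    (hξ : ξ ∈ sphere (0 : ℍ[ℝ]) 1) : 0 < ‖z - ξ‖ := by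
  rw [norm_pos_iff, sub_ne_zero]
  rintro rfl
  rw [mem_ball_zero_iff] at hz
  rw [mem_sphere_zero_iff_norm] at hξ
  exact hz.ne hξ

theorem hasDerivAt_norm_sq_line {e : ℍ[ℝ]} (he : ‖e‖ = 1) (z : ℍ[ℝ]) :
    HasDerivAt (fun t : ℝ => ‖z + t • e‖ ^ 2) (2 * inner ℝ z e) 0 := by
  have hquad : (fun t : ℝ => ‖z + t • e‖ ^ 2)
      = fun t => ‖z‖ ^ 2 + 2 * t * inner ℝ z e + t ^ 2 := by
    funext t
    rw [norm_add_sq_real, norm_smul, he, inner_smul_right, mul_one, Real.norm_eq_abs, sq_abs]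
    ring
  rw [hquad]
  refine (((((hasDerivAt_id (0 : ℝ)).const_mul 2).mul_const (inner ℝ z e)).const_add
    (‖z‖ ^ 2)).add ((hasDerivAt_id (0 : ℝ)).pow 2)).congr_deriv ?_
  simp

theorem hasDerivAt_norm_sub_sq_line {e : ℍ[ℝ]} (he : ‖e‖ = 1) (z ξ : ℍ[ℝ]) :
    HasDerivAt (fun t : ℝ => ‖z + t • e - ξ‖ ^ 2) (2 * inner ℝ (z - ξ) e) 0 := by
  simpa only [sub_add_eq_add_sub] using hasDerivAt_norm_sq_line he (z - ξ)

theorem hasDerivAt_inner_line {e : ℍ[ℝ]} (he : ‖e‖ = 1) (z : ℍ[ℝ]) :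
    HasDerivAt (fun t : ℝ => inner ℝ (z + t • e) e) 1 0 := by
  have h : (fun t : ℝ => inner ℝ (z + t • e) e) = fun t => inner ℝ z e + t := by
    funext t
    rw [inner_add_left, real_inner_smul_left, real_inner_self_eq_norm_sq, he]; ring
  rw [h]
  exact (hasDerivAt_id (0 : ℝ)).const_add _

theorem hasLineDerivAt_pker {e z ξ : ℍ[ℝ]} (he : ‖e‖ = 1) (h : 0 < ‖z - ξ‖) :
    HasLineDerivAt ℝ (fun w => pker w ξ) (pkerDeriv e z ξ) z e := by
  have hb := hasDerivAt_norm_sub_sq_line he z ξ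
  have h4 : ((fun t : ℝ => ‖z + t • e - ξ‖ ^ 2) ^ 2) 0 ≠ 0 := by
    simpa using h.ne'
  have key := ((hasDerivAt_norm_sq_line he z).const_sub 1).div (hb.pow 2) h4
  refine (key.congr_of_eventuallyEq (.of_forall fun t => ?_)).congr_deriv ?_
  · simp only [pker, Pi.div_apply, Pi.pow_apply]
    ring
  · simp only [pkerDeriv, Pi.pow_apply, zero_smul, add_zero]
    field_simp
    ring

theorem hasLineDerivAt_pkerDeriv {e z ξ : ℍ[ℝ]} (he : ‖e‖ = 1) (h : 0 < ‖z - ξ‖) :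
    HasLineDerivAt ℝ (fun w => pkerDeriv e w ξ) (pkerDeriv₂ e z ξ) z e := by
  have hb := hasDerivAt_norm_sub_sq_line he z ξ
  have h4 : ((fun t : ℝ => ‖z + t • e - ξ‖ ^ 2) ^ 2) 0 ≠ 0 := by
    simpa using h.ne'
  have h6 : ((fun t : ℝ => ‖z + t • e - ξ‖ ^ 2) ^ 3) 0 ≠ 0 := by
    simpa using h.ne'
  have hi : HasDerivAt (fun t : ℝ => inner ℝ (z + t • e - ξ) e) 1 0 := by
    simpa only [sub_add_eq_add_sub] using hasDerivAt_inner_line he (z - ξ)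
  have key := (((hasDerivAt_inner_line he z).const_mul (-2)).div (hb.pow 2) h4).sub
    (((((hasDerivAt_norm_sq_line he z).const_sub 1).const_mul 4).mul hi).div (hb.pow 3) h6)
  refine (key.congr_of_eventuallyEq (.of_forall fun t => ?_)).congr_deriv ?_
  · simp only [pkerDeriv, Pi.div_apply, Pi.pow_apply, Pi.sub_apply, Pi.mul_apply]
    ring
  · simp only [pkerDeriv₂, Pi.pow_apply, Pi.mul_apply, zero_smul, add_zero]
    field_simp
    ring

theorem sum_pkerDeriv₂ {z ξ : ℍ[ℝ]} (h : 0 < ‖z - ξ‖) (hξ : ξ ∈ sphere (0 : ℍ[ℝ]) 1) :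
    ∑ j, pkerDeriv₂ (qe j) z ξ = 0 := by
  rw [mem_sphere_zero_iff_norm] at hξ
  have hb : ‖z - ξ‖ ^ 2 = ‖z‖ ^ 2 - 2 * inner ℝ z ξ + 1 := by
    rw [norm_sub_sq_real, hξ]; ring
  simp only [pkerDeriv₂, Finset.sum_add_distrib, Finset.sum_sub_distrib, ← Finset.sum_div,
    ← Finset.mul_sum, sum_inner_qe_mul_inner_qe, real_inner_self_eq_norm_sq,
    Finset.sum_const, Finset.card_univ, Fintype.card_fin, nsmul_eq_mul]
  rw [inner_sub_right, real_inner_self_eq_norm_sq]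
  push_cast
  field_simp
  linear_combination (-8) * hb

theorem continuousOn_pker :
    ContinuousOn (Function.uncurry pker) (ball (0 : ℍ[ℝ]) 1 ×ˢ sphere (0 : ℍ[ℝ]) 1) := by
  unfold pker Function.uncurry
  exact ContinuousOn.div (by fun_prop) (by fun_prop) fun x hx =>
    (pow_pos (norm_sub_sphere_pos hx.1 hx.2) _).ne'

theorem continuousOn_pkerDeriv (e : ℍ[ℝ]) :
    ContinuousOn (Function.uncurry (pkerDeriv e))
      (ball (0 : ℍ[ℝ]) 1 ×ˢ sphere (0 : ℍ[ℝ]) 1) := by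
  unfold pkerDeriv Function.uncurry
  refine ContinuousOn.sub (ContinuousOn.div ?_ ?_ fun x hx => ?_)
    (ContinuousOn.div ?_ ?_ fun x hx => ?_) <;>
  first
  | exact (pow_pos (norm_sub_sphere_pos hx.1 hx.2) _).ne'
  | fun_prop

theorem continuousOn_pkerDeriv₂ (e : ℍ[ℝ]) :
    ContinuousOn (Function.uncurry (pkerDeriv₂ e))
      (ball (0 : ℍ[ℝ]) 1 ×ˢ sphere (0 : ℍ[ℝ]) 1) := by
  unfold pkerDeriv₂ Function.uncurry
  refine ContinuousOn.add (ContinuousOn.sub (ContinuousOn.add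
    (ContinuousOn.div ?_ ?_ fun x hx => ?_) (ContinuousOn.div ?_ ?_ fun x hx => ?_))
    (ContinuousOn.div ?_ ?_ fun x hx => ?_)) (ContinuousOn.div ?_ ?_ fun x hx => ?_) <;>
  first
  | exact (pow_pos (norm_sub_sphere_pos hx.1 hx.2) _).ne'
  | fun_prop

theorem pker_nonneg {z : ℍ[ℝ]} (hz : z ∈ ball (0 : ℍ[ℝ]) 1) (ξ : ℍ[ℝ]) : 0 ≤ pker z ξ := by
  rw [mem_ball_zero_iff] at hz
  exact div_nonneg (by nlinarith [norm_nonneg z]) (by positivity)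

theorem pker_mul_norm_sub_le {z ξ : ℍ[ℝ]} (hz : z ∈ ball (0 : ℍ[ℝ]) 1) {δ : ℝ} (hδ : 0 < δ) :
    pker z ξ * ‖z - ξ‖ ≤ δ * pker z ξ + (1 - ‖z‖ ^ 2) / δ ^ 3 := by
  have h0 := pker_nonneg hz ξ
  have ha : 0 ≤ 1 - ‖z‖ ^ 2 := by
    rw [mem_ball_zero_iff] at hz
    nlinarith [norm_nonneg z]
  rcases le_total ‖z - ξ‖ δ with h | h
  · have : 0 ≤ (1 - ‖z‖ ^ 2) / δ ^ 3 := by positivity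
    nlinarith
  · have hb : 0 < ‖z - ξ‖ := hδ.trans_le h
    have h1 : pker z ξ * ‖z - ξ‖ = (1 - ‖z‖ ^ 2) / ‖z - ξ‖ ^ 3 := by
      unfold pker; field_simp
    have h2 : (1 - ‖z‖ ^ 2) / ‖z - ξ‖ ^ 3 ≤ (1 - ‖z‖ ^ 2) / δ ^ 3 := by gcongr
    have : 0 ≤ δ * pker z ξ := by positivity
    linarith

variable {F : Type*} [NormedAddCommGroup F] [NormedSpace ℝ F]

theorem ContinuousOn.smul_uncurry_boundary {k : ℍ[ℝ] → ℍ[ℝ] → ℝ} {H : ℍ[ℝ] → F}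
    (hk : ContinuousOn (Function.uncurry k) (ball (0 : ℍ[ℝ]) 1 ×ˢ sphere (0 : ℍ[ℝ]) 1))
    (hH : ContinuousOn H (sphere 0 1)) :
    ContinuousOn (Function.uncurry fun z ξ => k z ξ • H ξ)
      (ball (0 : ℍ[ℝ]) 1 ×ˢ sphere (0 : ℍ[ℝ]) 1) :=
  hk.smul (hH.comp continuousOn_snd fun _ hx => hx.2)

theorem integrableOn_smul_boundary {ψ : Measure ℍ[ℝ]} [IsFiniteMeasure ψ]
    {k : ℍ[ℝ] → ℍ[ℝ] → ℝ} {H : ℍ[ℝ] → F}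
    (hk : ContinuousOn (Function.uncurry k) (ball (0 : ℍ[ℝ]) 1 ×ˢ sphere (0 : ℍ[ℝ]) 1))
    (hH : ContinuousOn H (sphere 0 1)) {z : ℍ[ℝ]} (hz : z ∈ ball (0 : ℍ[ℝ]) 1) :
    IntegrableOn (fun ξ => k z ξ • H ξ) (sphere 0 1) ψ := by
  have hc : ContinuousOn (fun ξ : ℍ[ℝ] => (z, ξ)) (sphere 0 1) := by fun_prop
  have hkz : ContinuousOn (k z) (sphere 0 1) := hk.comp hc fun _ hξ => ⟨hz, hξ⟩
  exact (hkz.smul hH).integrableOn_compact' (isCompact_sphere _ _) isClosed_sphere.measurableSet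

theorem hasLineDerivAt_poissonIntegral {ψ : Measure ℍ[ℝ]} [IsFiniteMeasure ψ] {H : ℍ[ℝ] → F}
    (hH : ContinuousOn H (sphere 0 1)) {e z : ℍ[ℝ]} (he : ‖e‖ = 1)
    (hz : z ∈ ball (0 : ℍ[ℝ]) 1) :
    HasLineDerivAt ℝ (fun z => ∫ ξ in sphere 0 1, pker z ξ • H ξ ∂ψ)
      (∫ ξ in sphere 0 1, pkerDeriv e z ξ • H ξ ∂ψ) z e :=
  hasLineDerivAt_integral_of_isCompact isOpen_ball (isCompact_sphere _ _)
    (continuousOn_pker.smul_uncurry_boundary hH)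
    ((continuousOn_pkerDeriv e).smul_uncurry_boundary hH)
    (fun _ hx ξ hξ => HasDerivAt.smul_const
      (hasLineDerivAt_pker he (norm_sub_sphere_pos hx hξ)) (H ξ)) hz

theorem isLineHarmonic_poissonIntegral {ψ : Measure ℍ[ℝ]} [IsFiniteMeasure ψ] {H : ℍ[ℝ] → F}
    (hH : ContinuousOn H (sphere 0 1)) :
    IsLineHarmonic fun z => ∫ ξ in sphere 0 1, pker z ξ • H ξ ∂ψ := by
  refine ⟨fun j z => ∫ ξ in sphere 0 1, pkerDeriv (qe j) z ξ • H ξ ∂ψ,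
    fun j z => ∫ ξ in sphere 0 1, pkerDeriv₂ (qe j) z ξ • H ξ ∂ψ,
    fun z hz => ⟨fun j => ⟨?_, ?_⟩, ?_⟩⟩
  · exact hasLineDerivAt_poissonIntegral hH (norm_qe j) hz
  · exact hasLineDerivAt_integral_of_isCompact isOpen_ball (isCompact_sphere _ _)
      ((continuousOn_pkerDeriv _).smul_uncurry_boundary hH)
      ((continuousOn_pkerDeriv₂ _).smul_uncurry_boundary hH)
      (fun _ hx ξ hξ => HasDerivAt.smul_const
        (hasLineDerivAt_pkerDeriv (norm_qe j) (norm_sub_sphere_pos hx hξ)) (H ξ)) hz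
  · rw [← integral_finsetSum _ fun j _ =>
      integrableOn_smul_boundary (continuousOn_pkerDeriv₂ (qe j)) hH hz]
    rw [setIntegral_congr_fun (g := fun _ => 0) isClosed_sphere.measurableSet, integral_zero]
    intro ξ hξ
    simp only [← Finset.sum_smul, sum_pkerDeriv₂ (norm_sub_sphere_pos hz hξ) hξ, zero_smul]

theorem continuousOn_poissonIntegral {ψ : Measure ℍ[ℝ]} [IsFiniteMeasure ψ] {H : ℍ[ℝ] → F}
    (hH : ContinuousOn H (sphere 0 1)) {r : ℝ} (hr : r < 1) :
    ContinuousOn (fun z => ∫ ξ in sphere 0 1, pker z ξ • H ξ ∂ψ) (closedBall 0 r) :=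
  continuousOn_integral_of_isCompact (isCompact_closedBall _ _) (isCompact_sphere _ _)
    ((continuousOn_pker.smul_uncurry_boundary hH).mono
      (Set.prod_mono (closedBall_subset_ball hr) subset_rfl))

end PoissonKernel

section PoissonFormula

variable {ψ : Measure ℍ[ℝ]}

theorem integral_pker_map [IsFiniteMeasure ψ] (hψsupp : ψ (sphere (0 : ℍ[ℝ]) 1)ᶜ = 0)
    (hψrot : ∀ T : ℍ[ℝ] ≃ₗᵢ[ℝ] ℍ[ℝ], ψ.map T = ψ) (T : ℍ[ℝ] ≃ₗᵢ[ℝ] ℍ[ℝ]) (z : ℍ[ℝ]) :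
    ∫ ξ in sphere 0 1, pker (T z) ξ ∂ψ = ∫ ξ in sphere 0 1, pker z ξ ∂ψ := by
  have hres : ψ.restrict (sphere 0 1) = ψ := Measure.restrict_eq_self_of_ae_mem
    (s := sphere (0 : ℍ[ℝ]) 1) (mem_ae_iff.2 hψsupp)
  rw [hres]
  conv_lhs => rw [← hψrot T]
  have h := T.toHomeomorph.measurableEmbedding.integral_map (μ := ψ) (pker (T z))
  refine h.trans (integral_congr_ae (.of_forall fun ξ => ?_))
  change pker (T z) (T ξ) = pker z ξ
  simp only [pker, ← map_sub, LinearIsometryEquiv.norm_map]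

theorem integral_pker_eq_one [IsFiniteMeasure ψ] (hψone : ψ (sphere (0 : ℍ[ℝ]) 1) = 1)
    (hψsupp : ψ (sphere (0 : ℍ[ℝ]) 1)ᶜ = 0)
    (hψrot : ∀ T : ℍ[ℝ] ≃ₗᵢ[ℝ] ℍ[ℝ], ψ.map T = ψ) {z : ℍ[ℝ]} (hz : z ∈ ball (0 : ℍ[ℝ]) 1) :
    ∫ ξ in sphere 0 1, pker z ξ ∂ψ = 1 := by
  have hr : ‖z‖ < 1 := by simpa using hz
  have h1 : ContinuousOn (fun _ : ℍ[ℝ] => (1 : ℝ)) (sphere 0 1) := continuousOn_const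
  have hharm := isLineHarmonic_poissonIntegral (ψ := ψ) h1
  have hcont := continuousOn_poissonIntegral (ψ := ψ) h1 hr
  simp only [smul_eq_mul, mul_one] at hharm hcont
  have h0 : ∫ ξ in sphere 0 1, pker 0 ξ ∂ψ = 1 := by
    rw [setIntegral_congr_fun (g := fun _ => 1) isClosed_sphere.measurableSet]
    · simp [Measure.real, hψone]
    · intro ξ hξ
      rw [mem_sphere_zero_iff_norm] at hξ
      simp [pker, hξ]
  have key := (hharm.sub
    (isLineHarmonic_const (∫ ξ in sphere 0 1, pker z ξ ∂ψ))).norm_le_of_sphere_norm_le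
    hr (c := 0) (hcont.sub continuousOn_const) (fun w hw => ?_)
    (mem_closedBall_self (norm_nonneg z))
  · simp only [Pi.sub_apply, h0] at key
    linarith [sub_eq_zero.1 (norm_le_zero_iff.1 key)]
  · have hwz : ‖z‖ = ‖w‖ := by simpa using hw.symm
    have := integral_pker_map hψsupp hψrot ((ℝ ∙ (z - w))ᗮ.reflection) z
    rw [Submodule.reflection_sub hwz] at this
    simp [this]

theorem norm_poissonIntegral_sub_le {F : Type*} [NormedAddCommGroup F] [NormedSpace ℝ F]
    [CompleteSpace F] [IsFiniteMeasure ψ] (hψone : ψ (sphere (0 : ℍ[ℝ]) 1) = 1)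
    (hψsupp : ψ (sphere (0 : ℍ[ℝ]) 1)ᶜ = 0)
    (hψrot : ∀ T : ℍ[ℝ] ≃ₗᵢ[ℝ] ℍ[ℝ], ψ.map T = ψ) {H : ℍ[ℝ] → F} {C : NNReal}
    (hH : LipschitzOnWith C H (closedBall 0 1)) {z : ℍ[ℝ]} (hz : z ∈ ball (0 : ℍ[ℝ]) 1)
    {δ : ℝ} (hδ : 0 < δ) :
    ‖(∫ ξ in sphere 0 1, pker z ξ • H ξ ∂ψ) - H z‖ ≤ C * (δ + (1 - ‖z‖ ^ 2) / δ ^ 3) := by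
  have hHs : ContinuousOn H (sphere 0 1) := hH.continuousOn.mono sphere_subset_closedBall
  have hone := integral_pker_eq_one hψone hψsupp hψrot hz
  have hi : IntegrableOn (fun ξ => pker z ξ • H z) (sphere 0 1) ψ :=
    integrableOn_smul_boundary continuousOn_pker continuousOn_const hz
  have hP : IntegrableOn (fun ξ => pker z ξ) (sphere 0 1) ψ := by
    simpa using integrableOn_smul_boundary (ψ := ψ) (H := fun _ => (1 : ℝ)) continuousOn_pker
      continuousOn_const hz
  have hsub : (∫ ξ in sphere 0 1, pker z ξ • H ξ ∂ψ) - H z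
      = ∫ ξ in sphere 0 1, pker z ξ • (H ξ - H z) ∂ψ := by
    simp only [smul_sub]
    rw [integral_sub (integrableOn_smul_boundary continuousOn_pker hHs hz) hi,
      integral_smul_const, hone, one_smul]
  rw [hsub]
  have hbound : ∫ ξ in sphere 0 1, C * (δ * pker z ξ + (1 - ‖z‖ ^ 2) / δ ^ 3) ∂ψ
      = C * (δ + (1 - ‖z‖ ^ 2) / δ ^ 3) := by
    rw [integral_const_mul, integral_add (hP.const_mul δ) (integrable_const _),
      integral_const_mul, hone]
    simp [Measure.real, hψone]
  rw [← hbound]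
  refine norm_integral_le_of_norm_le (((hP.const_mul δ).add (integrable_const _)).const_mul _)
    ((ae_restrict_mem isClosed_sphere.measurableSet).mono fun ξ hξ => ?_)
  have hd := hH.norm_sub_le (sphere_subset_closedBall hξ) (ball_subset_closedBall hz)
  rw [norm_smul, Real.norm_of_nonneg (pker_nonneg hz ξ)]
  calc pker z ξ * ‖H ξ - H z‖ ≤ pker z ξ * (C * ‖ξ - z‖) :=
        mul_le_mul_of_nonneg_left hd (pker_nonneg hz ξ)
    _ = C * (pker z ξ * ‖z - ξ‖) := by rw [norm_sub_rev]; ring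
    _ ≤ _ := mul_le_mul_of_nonneg_left (pker_mul_norm_sub_le hz hδ) C.coe_nonneg

theorem IsLineHarmonic.eq_poissonIntegral {F : Type*} [NormedAddCommGroup F]
    [InnerProductSpace ℝ F] [CompleteSpace F] [IsFiniteMeasure ψ]
    (hψone : ψ (sphere (0 : ℍ[ℝ]) 1) = 1) (hψsupp : ψ (sphere (0 : ℍ[ℝ]) 1)ᶜ = 0)
    (hψrot : ∀ T : ℍ[ℝ] ≃ₗᵢ[ℝ] ℍ[ℝ], ψ.map T = ψ) {H : ℍ[ℝ] → F} (hharm : IsLineHarmonic H)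
    {C : NNReal} (hH : LipschitzOnWith C H (closedBall 0 1)) {z : ℍ[ℝ]}
    (hz : z ∈ ball (0 : ℍ[ℝ]) 1) :
    ∫ ξ in sphere 0 1, pker z ξ • H ξ ∂ψ = H z := by
  have hHs : ContinuousOn H (sphere 0 1) := hH.continuousOn.mono sphere_subset_closedBall
  have hz1 : ‖z‖ < 1 := by simpa using hz
  have key : ∀ δ > 0, ∀ r ∈ Set.Ico ‖z‖ 1,
      ‖(∫ ξ in sphere 0 1, pker z ξ • H ξ ∂ψ) - H z‖ ≤ C * (δ + (1 - r ^ 2) / δ ^ 3) := by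
    intro δ hδ r hr
    refine ((isLineHarmonic_poissonIntegral hHs).sub hharm).norm_le_of_sphere_norm_le hr.2
      ((continuousOn_poissonIntegral hHs hr.2).sub
        (hH.continuousOn.mono (closedBall_subset_closedBall hr.2.le)))
      (fun w hw => ?_) (by simpa using hr.1)
    have hw' : ‖w‖ = r := by simpa using hw
    rw [← hw']
    exact norm_poissonIntegral_sub_le hψone hψsupp hψrot hH (by simpa [hw'] using hr.2) hδ
  have key' : ∀ δ > 0, ‖(∫ ξ in sphere 0 1, pker z ξ • H ξ ∂ψ) - H z‖ ≤ C * δ := by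
    intro δ hδ
    have hlim : Tendsto (fun r : ℝ => C * (δ + (1 - r ^ 2) / δ ^ 3)) (𝓝[<] 1) (𝓝 (C * δ)) := by
      have : Continuous fun r : ℝ => C * (δ + (1 - r ^ 2) / δ ^ 3) := by fun_prop
      simpa using (this.tendsto 1).mono_left nhdsWithin_le_nhds
    exact ge_of_tendsto hlim (Filter.mem_of_superset (Ico_mem_nhdsLT hz1) fun r hr => key δ hδ r hr)
  have hlim : Tendsto (fun δ : ℝ => C * δ) (𝓝[>] 0) (𝓝 0) := by
    have : Continuous fun δ : ℝ => C * δ := by fun_prop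
    simpa using (this.tendsto 0).mono_left nhdsWithin_le_nhds
  rw [← sub_eq_zero, ← norm_le_zero_iff]
  exact ge_of_tendsto hlim (eventually_mem_nhdsWithin.mono fun δ hδ => key' δ hδ)

end PoissonFormula

section QuaternionAlgebra

theorem re_qe (j : Fin 4) : (qe j).re = ![1, 0, 0, 0] j := by fin_cases j <;> rfl

theorem imI_qe (j : Fin 4) : (qe j).imI = ![0, 1, 0, 0] j := by fin_cases j <;> rfl

theorem imJ_qe (j : Fin 4) : (qe j).imJ = ![0, 0, 1, 0] j := by fin_cases j <;> rfl

theorem imK_qe (j : Fin 4) : (qe j).imK = ![0, 0, 0, 1] j := by fin_cases j <;> rfl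

theorem sum_mul_star_qe (a z : ℍ[ℝ]) (L : ℍ[ℝ] →L[ℝ] ℍ[ℝ]) (hL : ∑ j, L (qe j) * qe j = 0) :
    ∑ j, (L (qe j) * z + a * qe j) * star (qe j) = 4 * a + 2 * L z := by
  have hz : z = z.re • qe 0 + z.imI • qe 1 + z.imJ • qe 2 + z.imK • qe 3 := by
    ext <;> simp [re_qe, imI_qe, imJ_qe, imK_qe]
  have hLz : L z = z.re • L (qe 0) + z.imI • L (qe 1) + z.imJ • L (qe 2) + z.imK • L (qe 3) := by
    conv_lhs => rw [hz]
    simp only [map_add, map_smul]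
  have hcomm : ∀ j, qe j * star z + z * star (qe j) = ((2 * inner ℝ z (qe j) : ℝ) : ℍ[ℝ]) := by
    intro j
    fin_cases j <;> ext <;> simp [re_qe, imI_qe, imJ_qe, imK_qe, inner_eq_sum_coords] <;> ring
  have hsq : ∀ j, qe j * star (qe j) = 1 := by
    intro j
    rw [Quaternion.self_mul_star, Quaternion.normSq_eq_norm_mul_self, norm_qe]; simp
  have hterm : ∀ j, (L (qe j) * z + a * qe j) * star (qe j)
      = (2 * inner ℝ z (qe j) : ℝ) • L (qe j) - L (qe j) * qe j * star z + a := by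
    intro j
    rw [add_mul, mul_assoc a, hsq, mul_one, mul_assoc, eq_sub_of_add_eq' (hcomm j), mul_sub,
      Quaternion.mul_coe_eq_smul, mul_assoc]
  simp only [hterm, Finset.sum_add_distrib, Finset.sum_sub_distrib, ← Finset.sum_mul, hL]
  rw [hLz]
  simp [Fin.sum_univ_four, inner_eq_sum_coords, re_qe, imI_qe, imJ_qe, imK_qe, mul_smul,
    two_mul, add_smul]
  abel

theorem sum_diag_eq_zero_of_sum_mul_qe_eq_zero {B : Fin 4 → Fin 4 → ℍ[ℝ]}
    (hsymm : ∀ j k, B j k = B k j) (hB : ∀ k, ∑ j, B k j * qe j = 0) : ∑ j, B j j = 0 := by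
  have h10 := hsymm 1 0
  have h20 := hsymm 2 0
  have h30 := hsymm 3 0
  have h21 := hsymm 2 1
  have h31 := hsymm 3 1
  have h32 := hsymm 3 2
  have hre := fun k => congrArg QuaternionAlgebra.re (hB k)
  have hI := fun k => congrArg QuaternionAlgebra.imI (hB k)
  have hJ := fun k => congrArg QuaternionAlgebra.imJ (hB k)
  have hK := fun k => congrArg QuaternionAlgebra.imK (hB k)
  simp only [Fin.sum_univ_four, re_qe, imI_qe, imJ_qe, imK_qe, Quaternion.re_add,
    Quaternion.imI_add, Quaternion.imJ_add, Quaternion.imK_add, Quaternion.re_mul,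
    Quaternion.imI_mul, Quaternion.imJ_mul,
    Quaternion.imK_mul, Quaternion.re_zero, Quaternion.imI_zero, Quaternion.imJ_zero,
    Quaternion.imK_zero, mul_one, mul_zero, add_zero, sub_zero, zero_sub, zero_add,
    Matrix.cons_val]
    at hre hI hJ hK ⊢
  have hre0 := hre 0
  have hre1 := hre 1
  have hre2 := hre 2
  have hre3 := hre 3
  have hI0 := hI 0
  have hI1 := hI 1
  have hI2 := hI 2
  have hI3 := hI 3
  have hJ0 := hJ 0
  have hJ1 := hJ 1
  have hJ2 := hJ 2
  have hJ3 := hJ 3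
  have hK0 := hK 0
  have hK1 := hK 1
  have hK2 := hK 2
  have hK3 := hK 3
  rw [h10] at hre1 hI1 hJ1 hK1
  rw [h20, h21] at hre2 hI2 hJ2 hK2
  rw [h30, h31, h32] at hre3 hI3 hJ3 hK3
  ext
  · simp only [Quaternion.re_add, Quaternion.re_zero]; linarith
  · simp only [Quaternion.imI_add, Quaternion.imI_zero]; linarith
  · simp only [Quaternion.imJ_add, Quaternion.imJ_zero]; linarith
  · simp only [Quaternion.imK_add, Quaternion.imK_zero]; linarith

end QuaternionAlgebra

section Regular

variable {A : ℍ[ℝ] → ℍ[ℝ]}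

theorem sum_fderiv_fderiv_qe_eq_zero (hA : ContDiff ℝ 2 A)
    (hD : ∀ z ∈ ball (0 : ℍ[ℝ]) 1, Dirac A z = 0) {z : ℍ[ℝ]} (hz : z ∈ ball (0 : ℍ[ℝ]) 1) :
    ∑ j, fderiv ℝ (fderiv ℝ A) z (qe j) (qe j) = 0 := by
  have hdd : DifferentiableAt ℝ (fderiv ℝ A) z :=
    (hA.fderiv_right (m := 1) (by norm_num)).differentiable one_ne_zero z
  refine sum_diag_eq_zero_of_sum_mul_qe_eq_zero
    (B := fun j k => fderiv ℝ (fderiv ℝ A) z (qe j) (qe k)) (fun j k => ?_) (fun k => ?_)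
  · exact hA.contDiffAt.isSymmSndFDerivAt (by simp) (qe j) (qe k)
  · have h1 : HasFDerivAt (Dirac A) (0 : ℍ[ℝ] →L[ℝ] ℍ[ℝ]) z := by
      refine (hasFDerivAt_const (0 : ℍ[ℝ]) z).congr_of_eventuallyEq ?_
      filter_upwards [isOpen_ball.mem_nhds hz] with w hw using hD w hw
    have h2 : HasLineDerivAt ℝ (Dirac A)
        (∑ j, fderiv ℝ (fderiv ℝ A) z (qe k) (qe j) * qe j) z (qe k) :=
      HasDerivAt.fun_sum fun j _ => HasDerivAt.mul_const
        ((ContinuousLinearMap.apply ℝ ℍ[ℝ] (qe j)).hasFDerivAt.comp_hasDerivAt (0 : ℝ)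
          (hdd.hasFDerivAt.hasLineDerivAt (qe k))) (qe j)
    exact h2.unique (h1.hasLineDerivAt (qe k))

theorem hasLineDerivAt_mul_id (hA : Differentiable ℝ A) (z e : ℍ[ℝ]) :
    HasLineDerivAt ℝ (fun w => A w * w) (fderiv ℝ A z e * z + A z * e) z e := by
  have h := HasDerivAt.mul ((hA z).hasFDerivAt.hasLineDerivAt e)
    ((hasFDerivAt_id z).hasLineDerivAt e)
  exact (h.congr_of_eventuallyEq (.of_forall fun t => rfl)).congr_deriv (by simp)

theorem isLineHarmonic_mul_id (hA : ContDiff ℝ 2 A)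
    (hD : ∀ z ∈ ball (0 : ℍ[ℝ]) 1, Dirac A z = 0) : IsLineHarmonic fun z => A z * z := by
  have hd : Differentiable ℝ A := hA.differentiable two_ne_zero
  have hdd : Differentiable ℝ (fderiv ℝ A) :=
    (hA.fderiv_right (m := 1) (by norm_num)).differentiable one_ne_zero
  refine ⟨fun j z => fderiv ℝ A z (qe j) * z + A z * qe j,
    fun j z => fderiv ℝ (fderiv ℝ A) z (qe j) (qe j) * z + fderiv ℝ A z (qe j) * qe j
      + fderiv ℝ A z (qe j) * qe j, fun z hz => ⟨fun j => ⟨?_, ?_⟩, ?_⟩⟩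
  · exact hasLineDerivAt_mul_id hd z (qe j)
  · have h1 : HasLineDerivAt ℝ (fun w => fderiv ℝ A w (qe j))
        (fderiv ℝ (fderiv ℝ A) z (qe j) (qe j)) z (qe j) :=
      (ContinuousLinearMap.apply ℝ ℍ[ℝ] (qe j)).hasFDerivAt.comp_hasDerivAt (0 : ℝ)
        ((hdd z).hasFDerivAt.hasLineDerivAt (qe j))
    have h2 := HasDerivAt.mul h1 ((hasFDerivAt_id z).hasLineDerivAt (qe j))
    have h3 := HasDerivAt.mul_const ((hd z).hasFDerivAt.hasLineDerivAt (qe j)) (qe j)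
    exact ((h2.add h3).congr_of_eventuallyEq (.of_forall fun t => rfl)).congr_deriv (by simp)
  · have hDz : ∑ j, fderiv ℝ A z (qe j) * qe j = 0 := hD z hz
    simp only [Finset.sum_add_distrib, ← Finset.sum_mul, sum_fderiv_fderiv_qe_eq_zero hA hD hz,
      hDz, zero_mul, add_zero]

theorem dstarP_eq_sum {z ξ : ℍ[ℝ]} (h : 0 < ‖z - ξ‖) :
    dstarP ξ z = ∑ j, pkerDeriv (qe j) z ξ • star (qe j) := by
  have hd : DifferentiableAt ℝ (fun w => pker w ξ) z := by
    unfold pker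
    simp only [show (4 : ℕ) = 2 * 2 from rfl, pow_mul, div_eq_mul_inv]
    have h1 : DifferentiableAt ℝ (fun w : ℍ[ℝ] => ‖w‖ ^ 2) z := differentiableAt_id.norm_sq ℝ
    have h2 : DifferentiableAt ℝ (fun w : ℍ[ℝ] => ‖w - ξ‖ ^ 2) z :=
      (differentiableAt_id.sub_const ξ).norm_sq ℝ
    have h3 : (‖z - ξ‖ ^ 2) ^ 2 ≠ 0 := by positivity
    exact (h1.const_sub 1).fun_mul ((h2.fun_pow 2).fun_inv h3)
  have hd' : HasFDerivAt (fun w => ((pker w ξ : ℝ) : ℍ[ℝ]))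
      ((algebraMapCLM ℝ ℍ[ℝ]).comp (fderiv ℝ (fun w => pker w ξ) z)) z :=
    (algebraMapCLM ℝ ℍ[ℝ]).hasFDerivAt.comp z hd.hasFDerivAt
  unfold dstarP DiracStar
  refine Finset.sum_congr rfl fun j _ => ?_
  rw [hd'.fderiv, ← (hd.hasFDerivAt.hasLineDerivAt (qe j)).unique
    (hasLineDerivAt_pker (norm_qe j) h)]
  exact Quaternion.coe_mul_eq_smul _ _

theorem continuousOn_dstarP {z : ℍ[ℝ]} (hz : z ∈ ball (0 : ℍ[ℝ]) 1) :
    ContinuousOn (fun ξ => dstarP ξ z) (sphere 0 1) := by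
  have hc : ContinuousOn (fun ξ : ℍ[ℝ] => (z, ξ)) (sphere 0 1) := by fun_prop
  refine ContinuousOn.congr (continuousOn_finsetSum _ fun j _ => ContinuousOn.smul
    ((continuousOn_pkerDeriv (qe j)).comp hc fun _ hξ => ⟨hz, hξ⟩)
    (continuousOn_const (c := star (qe j)))) fun ξ hξ =>
    dstarP_eq_sum (norm_sub_sphere_pos hz hξ)

theorem integral_mul_id_mul_dstarP {ψ : Measure ℍ[ℝ]} [IsFiniteMeasure ψ]
    (hψone : ψ (sphere (0 : ℍ[ℝ]) 1) = 1) (hψsupp : ψ (sphere (0 : ℍ[ℝ]) 1)ᶜ = 0)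
    (hψrot : ∀ T : ℍ[ℝ] ≃ₗᵢ[ℝ] ℍ[ℝ], ψ.map T = ψ) (hA : ContDiff ℝ 2 A)
    (hD : ∀ z ∈ ball (0 : ℍ[ℝ]) 1, Dirac A z = 0) {z : ℍ[ℝ]} (hz : z ∈ ball (0 : ℍ[ℝ]) 1) :
    ∫ ξ in sphere 0 1, A ξ * ξ * dstarP ξ z ∂ψ = 4 * A z + 2 * fderiv ℝ A z z := by
  have hH : ContDiff ℝ 2 fun z => A z * z := hA.mul contDiff_id
  have hHc : ContinuousOn (fun z => A z * z) (sphere (0 : ℍ[ℝ]) 1) := hH.continuous.continuousOn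
  obtain ⟨C, hC⟩ := (hH.contDiffOn (s := closedBall 0 1)).exists_lipschitzOnWith two_ne_zero
    (convex_closedBall _ _) (isCompact_closedBall _ _)
  have hpart : ∀ j, ∫ ξ in sphere 0 1, pkerDeriv (qe j) z ξ • (A ξ * ξ) ∂ψ
      = fderiv ℝ A z (qe j) * z + A z * qe j := fun j => by
    refine ((hasLineDerivAt_poissonIntegral hHc (norm_qe j) hz).congr_of_eventuallyEq ?_).unique
      (hasLineDerivAt_mul_id (hA.differentiable two_ne_zero) z (qe j))
    filter_upwards [isOpen_ball.mem_nhds hz] with w hw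
    exact ((isLineHarmonic_mul_id hA hD).eq_poissonIntegral hψone hψsupp hψrot hC hw).symm
  rw [← sum_mul_star_qe (A z) z (fderiv ℝ A z) (hD z hz)]
  simp only [← hpart, ← integral_mul_const_of_integrable
    (integrableOn_smul_boundary (continuousOn_pkerDeriv (qe _)) hHc hz)]
  rw [← integral_finsetSum _ fun j _ =>
      (integrableOn_smul_boundary (continuousOn_pkerDeriv (qe j)) hHc hz).mul_const _]
  refine setIntegral_congr_fun isClosed_sphere.measurableSet fun ξ hξ => ?_
  simp only [dstarP_eq_sum (norm_sub_sphere_pos hz hξ), Finset.mul_sum]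
  exact Finset.sum_congr rfl fun j _ => by rw [mul_smul_comm, smul_mul_assoc]

end Regular

section BoundaryDensity

theorem fderiv_comp_smul_apply {A : ℍ[ℝ] → ℍ[ℝ]} (hA : Differentiable ℝ A) (t : ℝ) (z v : ℍ[ℝ]) :
    fderiv ℝ (fun w => A (t • w)) z v = t • fderiv ℝ A (t • z) v := by
  have h : HasFDerivAt (fun w => A (t • w))
      ((fderiv ℝ A (t • z)).comp (t • ContinuousLinearMap.id ℝ ℍ[ℝ])) z :=
    (hA (t • z)).hasFDerivAt.comp z ((hasFDerivAt_id z).const_smul t)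
  simp [h.fderiv]

theorem Dirac_comp_smul {A : ℍ[ℝ] → ℍ[ℝ]} (hA : Differentiable ℝ A) (t : ℝ) (z : ℍ[ℝ]) :
    Dirac (fun w => A (t • w)) z = t • Dirac A (t • z) := by
  simp only [Dirac, fderiv_comp_smul_apply hA, smul_mul_assoc, Finset.smul_sum]

/-- The boundary density `∫₀¹ (t / 2) f(tξ) ξ dt` which represents a regular function `f`. -/
noncomputable def boundaryDensity (f : ℍ[ℝ] → ℍ[ℝ]) (ξ : ℍ[ℝ]) : ℍ[ℝ] :=
  ∫ t in Set.Icc (0 : ℝ) 1, (t / 2) • (f (t • ξ) * ξ)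

theorem smul_mem_closedBall_of_mem_Icc {t : ℝ} (ht : t ∈ Set.Icc (0 : ℝ) 1) {ξ : ℍ[ℝ]}
    (hξ : ξ ∈ closedBall (0 : ℍ[ℝ]) 1) : t • ξ ∈ closedBall (0 : ℍ[ℝ]) 1 := by
  rw [mem_closedBall_zero_iff] at hξ ⊢
  rw [norm_smul, Real.norm_of_nonneg ht.1]
  exact mul_le_one₀ ht.2 (norm_nonneg _) hξ

theorem continuousOn_boundaryDensity_integrand {f : ℍ[ℝ] → ℍ[ℝ]}
    (hf : ContinuousOn f (closedBall 0 1)) :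
    ContinuousOn (Function.uncurry fun (ξ : ℍ[ℝ]) (t : ℝ) => (t / 2) • (f (t • ξ) * ξ))
      (sphere (0 : ℍ[ℝ]) 1 ×ˢ Set.Icc (0 : ℝ) 1) := by
  have h : ContinuousOn (fun p : ℍ[ℝ] × ℝ => f (p.2 • p.1))
      (sphere (0 : ℍ[ℝ]) 1 ×ˢ Set.Icc (0 : ℝ) 1) :=
    hf.comp (by fun_prop) fun p hp =>
      smul_mem_closedBall_of_mem_Icc hp.2 (sphere_subset_closedBall hp.1)
  exact ContinuousOn.smul (f := fun p : ℍ[ℝ] × ℝ => p.2 / 2) (by fun_prop) (h.mul continuousOn_fst)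

theorem integrableOn_boundaryDensity_integrand {f : ℍ[ℝ] → ℍ[ℝ]}
    (hf : ContinuousOn f (closedBall 0 1)) {ξ : ℍ[ℝ]} (hξ : ξ ∈ sphere (0 : ℍ[ℝ]) 1) :
    IntegrableOn (fun t : ℝ => (t / 2) • (f (t • ξ) * ξ)) (Set.Icc (0 : ℝ) 1) :=
  ((continuousOn_boundaryDensity_integrand hf).comp
    (by fun_prop : ContinuousOn (fun t : ℝ => (ξ, t)) (Set.Icc 0 1))
    fun _ ht => ⟨hξ, ht⟩).integrableOn_compact isCompact_Icc

theorem continuousOn_boundaryDensity {f : ℍ[ℝ] → ℍ[ℝ]} (hf : ContinuousOn f (closedBall 0 1)) :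
    ContinuousOn (boundaryDensity f) (sphere 0 1) := by
  have h := continuousOn_integral_of_isCompact (μ := volume.restrict (Set.Icc (0 : ℝ) 1))
    (isCompact_sphere (0 : ℍ[ℝ]) 1) isCompact_Icc (continuousOn_boundaryDensity_integrand hf)
  rwa [Measure.restrict_restrict measurableSet_Icc, Set.inter_self] at h

theorem norm_boundaryDensity_sub_le {f g : ℍ[ℝ] → ℍ[ℝ]} (hf : ContinuousOn f (closedBall 0 1))
    (hg : ContinuousOn g (closedBall 0 1)) {ε : ℝ}
    (hfg : ∀ z ∈ closedBall (0 : ℍ[ℝ]) 1, ‖f z - g z‖ ≤ ε) {ξ : ℍ[ℝ]}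
    (hξ : ξ ∈ sphere (0 : ℍ[ℝ]) 1) : ‖boundaryDensity f ξ - boundaryDensity g ξ‖ ≤ ε := by
  rw [boundaryDensity, boundaryDensity, ← integral_sub
    (integrableOn_boundaryDensity_integrand hf hξ) (integrableOn_boundaryDensity_integrand hg hξ)]
  refine (norm_setIntegral_le_of_norm_le_const (C := ε) (by simp) fun t ht => ?_).trans (by simp)
  have h := hfg _ (smul_mem_closedBall_of_mem_Icc ht (sphere_subset_closedBall hξ))
  rw [← smul_sub, ← sub_mul, norm_smul, norm_mul, mem_sphere_zero_iff_norm.1 hξ, mul_one,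
    Real.norm_of_nonneg (by linarith [ht.1])]
  nlinarith [norm_nonneg (f (t • ξ) - g (t • ξ)), ht.1, ht.2]

variable {F : ℍ[ℝ] → ℍ[ℝ]}

theorem integral_ray_eq (hF : ContDiff ℝ 1 F) (z : ℍ[ℝ]) :
    ∫ t in Set.Icc (0 : ℝ) 1, ((2 * t) • F (t • z) + t ^ 2 • fderiv ℝ F (t • z) z) = F z := by
  have hc : Continuous fun t : ℝ => (2 * t) • F (t • z) + t ^ 2 • fderiv ℝ F (t • z) z := by
    have h1 := hF.continuous
    have h2 := hF.continuous_fderiv one_ne_zero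
    fun_prop
  have hd : ∀ t : ℝ, HasDerivAt (fun t : ℝ => t ^ 2 • F (t • z))
      ((2 * t) • F (t • z) + t ^ 2 • fderiv ℝ F (t • z) z) t := by
    intro t
    have h1 : HasDerivAt (fun t : ℝ => F (t • z)) (fderiv ℝ F (t • z) z) t := by
      exact (((hF.differentiable one_ne_zero) (t • z)).hasFDerivAt.comp_hasDerivAt t
        ((hasDerivAt_id t).smul_const z)).congr_deriv (by simp)
    refine (HasDerivAt.fun_smul (hasDerivAt_pow 2 t) h1).congr_deriv ?_
    simp [add_comm]
  rw [integral_Icc_eq_integral_Ioc, ← intervalIntegral.integral_of_le zero_le_one,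
    intervalIntegral.integral_eq_sub_of_hasDerivAt (fun t _ => hd t) (hc.intervalIntegrable _ _)]
  simp

theorem integral_boundaryDensity_mul_dstarP {ψ : Measure ℍ[ℝ]} [IsFiniteMeasure ψ]
    (hψone : ψ (sphere (0 : ℍ[ℝ]) 1) = 1) (hψsupp : ψ (sphere (0 : ℍ[ℝ]) 1)ᶜ = 0)
    (hψrot : ∀ T : ℍ[ℝ] ≃ₗᵢ[ℝ] ℍ[ℝ], ψ.map T = ψ) (hF : ContDiff ℝ 2 F)
    (hD : ∀ z ∈ ball (0 : ℍ[ℝ]) 1, Dirac F z = 0) {z : ℍ[ℝ]} (hz : z ∈ ball (0 : ℍ[ℝ]) 1) :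
    ∫ ξ in sphere 0 1, boundaryDensity F ξ * dstarP ξ z ∂ψ = F z := by
  have hFd := hF.differentiable two_ne_zero
  have hFc : ContinuousOn F (closedBall 0 1) := hF.continuous.continuousOn
  have hray : ∀ t ∈ Set.Icc (0 : ℝ) 1,
      ∫ ξ in sphere 0 1, (t / 2) • (F (t • ξ) * ξ) * dstarP ξ z ∂ψ
        = (2 * t) • F (t • z) + t ^ 2 • fderiv ℝ F (t • z) z := by
    intro t ht
    have hDt : ∀ w ∈ ball (0 : ℍ[ℝ]) 1, Dirac (fun w => F (t • w)) w = 0 := by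
      intro w hw
      rw [Dirac_comp_smul hFd, hD, smul_zero]
      rw [mem_ball_zero_iff] at hw ⊢
      rw [norm_smul, Real.norm_of_nonneg ht.1]
      exact (mul_le_of_le_one_left (norm_nonneg _) ht.2).trans_lt hw
    have h := integral_mul_id_mul_dstarP hψone hψsupp hψrot
      (hF.comp (contDiff_const_smul t)) hDt hz
    simp only [smul_mul_assoc, integral_smul]
    refine (congrArg ((t / 2) • ·) h).trans ?_
    have h4 : ∀ x : ℍ[ℝ], 4 * x = (4 : ℝ) • x := fun x => by rw [Algebra.smul_def, map_ofNat]
    have h2 : ∀ x : ℍ[ℝ], 2 * x = (2 : ℝ) • x := fun x => by rw [Algebra.smul_def, map_ofNat]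
    simp only [Function.comp_def, fderiv_comp_smul_apply hFd, h4, h2, smul_add, smul_smul]
    congr 2 <;> ring
  have hcont : ContinuousOn
      (Function.uncurry fun (ξ : ℍ[ℝ]) (t : ℝ) => (t / 2) • (F (t • ξ) * ξ) * dstarP ξ z)
      (sphere (0 : ℍ[ℝ]) 1 ×ˢ Set.Icc (0 : ℝ) 1) :=
    (continuousOn_boundaryDensity_integrand hFc).mul
      ((continuousOn_dstarP hz).comp continuousOn_fst fun _ hp => hp.1)
  have hint : Integrable
      (Function.uncurry fun (ξ : ℍ[ℝ]) (t : ℝ) => (t / 2) • (F (t • ξ) * ξ) * dstarP ξ z)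
      ((ψ.restrict (sphere 0 1)).prod (volume.restrict (Set.Icc (0 : ℝ) 1))) := by
    rw [Measure.prod_restrict]
    exact hcont.integrableOn_compact' ((isCompact_sphere _ _).prod isCompact_Icc)
      (isClosed_sphere.measurableSet.prod measurableSet_Icc)
  calc ∫ ξ in sphere 0 1, boundaryDensity F ξ * dstarP ξ z ∂ψ
      = ∫ ξ in sphere 0 1, (∫ t in Set.Icc (0 : ℝ) 1,
          (t / 2) • (F (t • ξ) * ξ) * dstarP ξ z) ∂ψ :=
        setIntegral_congr_fun isClosed_sphere.measurableSet fun ξ hξ =>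
          (integral_mul_const_of_integrable (integrableOn_boundaryDensity_integrand hFc hξ)).symm
    _ = ∫ t in Set.Icc (0 : ℝ) 1, ∫ ξ in sphere 0 1,
          (t / 2) • (F (t • ξ) * ξ) * dstarP ξ z ∂ψ := integral_integral_swap hint
    _ = F z := by
        rw [setIntegral_congr_fun measurableSet_Icc hray, integral_ray_eq (hF.of_le one_le_two)]

end BoundaryDensity

section Approximation

theorem Filter.EventuallyEq.dirac_eq {f g : ℍ[ℝ] → ℍ[ℝ]} {z : ℍ[ℝ]} (h : f =ᶠ[𝓝 z] g) :
    Dirac f z = Dirac g z := by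
  simp only [Dirac, h.fderiv_eq]

theorem fderiv_convolution_lsmul_apply {E F : Type*} [NormedAddCommGroup E] [NormedSpace ℝ E]
    [MeasurableSpace E] [BorelSpace E] [NormedAddCommGroup F] [NormedSpace ℝ F] [CompleteSpace F]
    {μ : Measure E} [SFinite μ] [μ.IsAddLeftInvariant] {k : E → ℝ} (hk : LocallyIntegrable k μ)
    {g : E → F} (hg : ContDiff ℝ 1 g) (hgc : HasCompactSupport g) (z v : E) :
    fderiv ℝ (convolution k g (ContinuousLinearMap.lsmul ℝ ℝ) μ) z v
      = ∫ t, k t • fderiv ℝ g (z - t) v ∂μ := by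
  have hd := hgc.hasFDerivAt_convolution_right (ContinuousLinearMap.lsmul ℝ ℝ) hk hg z
  rw [hd.fderiv,
    convolution_precompR_apply _ hk (hgc.fderiv ℝ) (hg.continuous_fderiv one_ne_zero)]
  rfl

theorem Dirac_convolution {k : ℍ[ℝ] → ℝ} (hk : Continuous k) (hkc : HasCompactSupport k)
    {g : ℍ[ℝ] → ℍ[ℝ]} (hg : ContDiff ℝ 1 g) (hgc : HasCompactSupport g) (z : ℍ[ℝ]) :
    Dirac (convolution k g (ContinuousLinearMap.lsmul ℝ ℝ) volume) z
      = ∫ t, k t • Dirac g (z - t) := by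
  have hint : ∀ j, Integrable fun t => k t • fderiv ℝ g (z - t) (qe j) := fun j => by
    have hgd : Continuous fun t => fderiv ℝ g (z - t) (qe j) :=
      ((hg.continuous_fderiv one_ne_zero).comp (continuous_const.sub continuous_id)).clm_apply
        continuous_const
    exact (hk.smul hgd).integrable_of_hasCompactSupport hkc.smul_right
  simp only [Dirac, fderiv_convolution_lsmul_apply hk.locallyIntegrable hg hgc, Finset.smul_sum,
    ← smul_mul_assoc]
  rw [integral_finsetSum _ fun j _ => (hint j).mul_const _]
  simp only [integral_mul_const_of_integrable (hint _)]

theorem exists_contDiff_approx {f : ℍ[ℝ] → ℍ[ℝ]} (hf : memK f) {ε : ℝ} (hε : 0 < ε) :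
    ∃ F : ℍ[ℝ] → ℍ[ℝ], ContDiff ℝ 2 F ∧ (∀ z ∈ ball (0 : ℍ[ℝ]) 1, Dirac F z = 0) ∧
      ∀ z ∈ closedBall (0 : ℍ[ℝ]) 1, ‖F z - f z‖ ≤ ε := by
  obtain ⟨hfc, hfd, hfD⟩ := hf
  obtain ⟨δ, hδ, hunif⟩ := Metric.uniformContinuousOn_iff.1
    ((isCompact_closedBall _ _).uniformContinuousOn_of_continuous hfc) (ε / 2) (half_pos hε)
  obtain ⟨r, hr, hr1⟩ := exists_between (max_lt zero_lt_one (sub_lt_self 1 hδ))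
  obtain ⟨hr0, hrδ⟩ := max_lt_iff.1 hr
  obtain ⟨r', hr', hr1'⟩ := exists_between hr1
  obtain ⟨r'', hr'', hr1''⟩ := exists_between hr1'
  let χ : ContDiffBump (0 : ℍ[ℝ]) := ⟨r', r'', hr0.trans hr', hr''⟩
  let g : ℍ[ℝ] → ℍ[ℝ] := fun z => χ z • f z
  have hgc : HasCompactSupport g := χ.hasCompactSupport.smul_right
  have hg : ContDiff ℝ 1 g := by
    refine contDiff_iff_contDiffAt.2 fun z => ?_
    by_cases hz : z ∈ tsupport g
    · have hz' : z ∈ closedBall (0 : ℍ[ℝ]) r'' :=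
        χ.tsupport_eq ▸ tsupport_smul_subset_left (⇑χ) f hz
      exact χ.contDiffAt.smul (hfd.contDiffAt
        (isOpen_ball.mem_nhds (closedBall_subset_ball hr1'' hz')))
    · exact contDiffAt_const.congr_of_eventuallyEq (notMem_tsupport_iff_eventuallyEq.1 hz)
  have hgf : Set.EqOn g f (ball 0 r') := fun z hz => by
    simp [g, χ.one_of_mem_closedBall (ball_subset_closedBall hz)]
  let φ : ContDiffBump (0 : ℍ[ℝ]) :=
    ⟨min δ (r' - r) / 2, min δ (r' - r), half_pos (lt_min hδ (sub_pos.2 hr')),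
      half_lt_self (lt_min hδ (sub_pos.2 hr'))⟩
  let G : ℍ[ℝ] → ℍ[ℝ] :=
    convolution (φ.normed volume) g (ContinuousLinearMap.lsmul ℝ ℝ) volume
  have hG : ContDiff ℝ 2 G := φ.hasCompactSupport_normed.contDiff_convolution_left _
    φ.contDiff_normed hg.continuous.locallyIntegrable
  have hnear : ∀ z ∈ closedBall (0 : ℍ[ℝ]) r, ∀ w ∈ ball z φ.rOut, w ∈ ball (0 : ℍ[ℝ]) r' := by
    intro z hz w hw
    refine ball_subset_ball' ?_ hw
    have : φ.rOut ≤ r' - r := min_le_right _ _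
    rw [mem_closedBall] at hz
    linarith
  have hscale : ∀ z ∈ closedBall (0 : ℍ[ℝ]) 1, r • z ∈ closedBall (0 : ℍ[ℝ]) r := by
    intro z hz
    rw [mem_closedBall_zero_iff] at hz ⊢
    rw [norm_smul, Real.norm_of_nonneg hr0.le]
    exact mul_le_of_le_one_right hr0.le hz
  refine ⟨fun z => G (r • z), hG.comp (contDiff_const_smul r), fun z hz => ?_, fun z hz => ?_⟩
  · rw [Dirac_comp_smul (hG.differentiable two_ne_zero),
      Dirac_convolution (φ.contDiff_normed (n := 0)).continuous φ.hasCompactSupport_normed hg hgc,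
      integral_eq_zero_of_ae (.of_forall fun t => ?_), smul_zero]
    by_cases ht : t ∈ ball (0 : ℍ[ℝ]) φ.rOut
    · have hw : r • z - t ∈ ball (0 : ℍ[ℝ]) r' :=
        hnear _ (hscale z (ball_subset_closedBall hz)) _ (by simpa using ht)
      have hD : Dirac g (r • z - t) = 0 :=
        (hgf.eventuallyEq_of_mem (isOpen_ball.mem_nhds hw)).dirac_eq.trans
          (hfD _ (ball_subset_ball hr1'.le hw))
      simp [hD]
    · have : φ.normed volume t = 0 := by
        rwa [← Function.notMem_support, φ.support_normed_eq]
      simp [this]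
  · have hrz := hscale z hz
    have hrz' : r • z ∈ ball (0 : ℍ[ℝ]) r' := closedBall_subset_ball hr' hrz
    have h1 : dist (G (r • z)) (g (r • z)) ≤ ε / 2 := by
      refine φ.dist_normed_convolution_le hg.continuous.aestronglyMeasurable fun w hw => ?_
      have hw' := hnear _ hrz w hw
      rw [hgf hw', hgf hrz']
      exact (hunif w (ball_subset_closedBall (ball_subset_ball hr1'.le hw')) _
        (ball_subset_closedBall (ball_subset_ball hr1'.le hrz'))
        ((mem_ball.1 hw).trans_le (min_le_left _ _))).le
    have h2 : dist (f (r • z)) (f z) ≤ ε / 2 := by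
      refine (hunif _ (closedBall_subset_closedBall hr1.le hrz) z hz ?_).le
      rw [mem_closedBall_zero_iff] at hz
      rw [dist_eq_norm, show r • z - z = (r - 1) • z by module, norm_smul, Real.norm_eq_abs,
        abs_of_neg (by linarith)]
      nlinarith
    rw [hgf hrz'] at h1
    rw [← dist_eq_norm]
    linarith [dist_triangle (G (r • z)) (f (r • z)) (f z)]

end Approximation

/-- Every `f ∈ K(B, ℍ)` is represented on `B` by a continuous boundary density `h` against
the kernel `σ*_z P(z, ξ)`; here `ψ` is the rotation-invariant probability measure on `S³`. -/
theorem memK_boundary_representation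
    (ψ : Measure ℍ[ℝ]) (hψone : ψ (sphere (0 : ℍ[ℝ]) 1) = 1)
    (hψsupp : ψ (sphere (0 : ℍ[ℝ]) 1)ᶜ = 0)
    (hψrot : ∀ T : ℍ[ℝ] ≃ₗᵢ[ℝ] ℍ[ℝ], ψ.map T = ψ)
    (f : ℍ[ℝ] → ℍ[ℝ]) (hf : memK f) :
    ∃ h : ℍ[ℝ] → ℍ[ℝ], ContinuousOn h (sphere (0 : ℍ[ℝ]) 1) ∧
      ∀ z ∈ ball (0 : ℍ[ℝ]) 1, f z = ∫ ξ, h ξ * dstarP ξ z ∂ψ := by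
  have hfin : IsFiniteMeasure ψ := ⟨by
    rw [← measure_add_measure_compl isClosed_sphere.measurableSet (s := sphere (0 : ℍ[ℝ]) 1),
      hψone, hψsupp]
    simp⟩
  refine ⟨boundaryDensity f, continuousOn_boundaryDensity hf.1, fun z hz => ?_⟩
  rw [← Measure.restrict_eq_self_of_ae_mem (μ := ψ) (s := sphere (0 : ℍ[ℝ]) 1)
    (mem_ae_iff.2 hψsupp)]
  have hint : ∀ {k : ℍ[ℝ] → ℍ[ℝ]}, ContinuousOn k (sphere 0 1) →
      IntegrableOn (fun ξ => k ξ * dstarP ξ z) (sphere 0 1) ψ := fun hk =>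
    (hk.mul (continuousOn_dstarP hz)).integrableOn_compact' (isCompact_sphere _ _)
      isClosed_sphere.measurableSet
  have hnorm : IntegrableOn (fun ξ => ‖dstarP ξ z‖) (sphere 0 1) ψ :=
    (continuousOn_dstarP hz).norm.integrableOn_compact' (isCompact_sphere _ _)
      isClosed_sphere.measurableSet
  set M := ∫ ξ in sphere 0 1, ‖dstarP ξ z‖ ∂ψ
  have key : ∀ ε > 0, ‖f z - ∫ ξ in sphere 0 1, boundaryDensity f ξ * dstarP ξ z ∂ψ‖
      ≤ ε * (1 + M) := by
    intro ε hε
    obtain ⟨F, hF, hD, hFf⟩ := exists_contDiff_approx hf hε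
    have hFc : ContinuousOn F (closedBall 0 1) := hF.continuous.continuousOn
    have h1 : ‖F z - f z‖ ≤ ε := hFf z (ball_subset_closedBall hz)
    have h2 : ‖F z - ∫ ξ in sphere 0 1, boundaryDensity f ξ * dstarP ξ z ∂ψ‖ ≤ ε * M := by
      rw [← integral_boundaryDensity_mul_dstarP hψone hψsupp hψrot hF hD hz,
        ← integral_sub (hint (continuousOn_boundaryDensity hFc))
          (hint (continuousOn_boundaryDensity hf.1)), ← integral_const_mul]
      refine norm_integral_le_of_norm_le (hnorm.const_mul ε)
        ((ae_restrict_mem isClosed_sphere.measurableSet).mono fun ξ hξ => ?_)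
      rw [← sub_mul, norm_mul]
      gcongr
      exact norm_boundaryDensity_sub_le hFc hf.1 hFf hξ
    rw [mul_add, mul_one]
    rw [norm_sub_rev] at h1
    exact (norm_sub_le_norm_sub_add_norm_sub _ _ _).trans (add_le_add h1 h2)
  have hlim : Tendsto (fun ε : ℝ => ε * (1 + M)) (𝓝[>] 0) (𝓝 0) := by
    have : Continuous fun ε : ℝ => ε * (1 + M) := by fun_prop
    simpa using (this.tendsto 0).mono_left nhdsWithin_le_nhds
  rw [← sub_eq_zero, ← norm_le_zero_iff]
  exact ge_of_tendsto hlim (eventually_mem_nhdsWithin.mono fun ε hε => key ε hε)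
end

section
/- For every z in the open unit ball B of ℍ and every w ∈ S³ (more generally for all z ≠ w in B̄ with z ∈ B), the adjoint Dirac operator applied in the variable z to the Poisson kernel satisfies σ*_z P(z, w) = −(2|z − w|²·z* + 4(1 − |z|²)·(z − w)*) / |z − w|⁶, where q* denotes quaternion conjugation. -/
open MeasureTheory Metric
open scoped Quaternion

/-- On a real-valued function with gradient `v`, the adjoint Dirac operator is `star v`. -/
theorem DiracStar_coe_of_hasFDerivAt {g : ℍ[ℝ] → ℝ} {v z : ℍ[ℝ]}
    (hg : HasFDerivAt g (innerSL ℝ v) z) :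
    DiracStar (fun x => ((g x : ℝ) : ℍ[ℝ])) z = star v := by
  have h : HasFDerivAt (fun x => ((g x : ℝ) : ℍ[ℝ]))
      ((Algebra.linearMap ℝ ℍ[ℝ]).toContinuousLinearMap.comp (innerSL ℝ v)) z :=
    (Algebra.linearMap ℝ ℍ[ℝ]).toContinuousLinearMap.hasFDerivAt.comp z hg
  rw [DiracStar, h.fderiv]
  ext <;> simp [Fin.sum_univ_four, Quaternion.inner_def, Quaternion.algebraMap_def] <;> simp [qe]

/-- The gradient of the Poisson kernel in its first variable. -/
theorem hasFDerivAt_pker {z w : ℍ[ℝ]} (hzw : z ≠ w) :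
    HasFDerivAt (fun x => pker x w)
      (innerSL ℝ (-((‖z - w‖ ^ 6)⁻¹ •
        ((2 * ‖z - w‖ ^ 2) • z + (4 * (1 - ‖z‖ ^ 2)) • (z - w))))) z := by
  have hne : ‖z - w‖ ≠ 0 := norm_ne_zero_iff.mpr (sub_ne_zero.mpr hzw)
  have hN : HasFDerivAt (fun x : ℍ[ℝ] => 1 - ‖x‖ ^ 2) _ z :=
    (hasFDerivAt_id z).norm_sq.const_sub 1
  have hM : HasFDerivAt (fun x : ℍ[ℝ] => ‖x - w‖ ^ 2) _ z :=
    ((hasFDerivAt_id z).sub_const w).norm_sq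
  have hI := ((hasDerivAt_pow 2 (‖z - w‖ ^ 2)).fun_inv
    (pow_ne_zero 2 (pow_ne_zero 2 hne))).comp_hasFDerivAt_of_eq z hM rfl
  have hD := hN.mul hI
  have hf : (fun x => pker x w) = fun x => (1 - ‖x‖ ^ 2) * ((‖x - w‖ ^ 2) ^ 2)⁻¹ := by
    funext x
    rw [pker, ← pow_mul, div_eq_mul_inv]
  rw [hf]
  refine HasFDerivAt.congr_fderiv hD ?_
  ext y
  simp
  field_simp
  ring

/-- Explicit formula
`σ*_z P(z, w) = −(2|z−w|²·z* + 4(1−|z|²)·(z−w)*)/|z−w|⁶k` for `z ∈ B`, `w ∈ B̄`, `z ≠ w`. -/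
theorem dstarP_formula
    (z w : ℍ[ℝ]) (hz : z ∈ ball (0 : ℍ[ℝ]) 1) (hw : w ∈ closedBall (0 : ℍ[ℝ]) 1)
    (hzw : z ≠ w) :
    dstarP w z =
      -((‖z - w‖ ^ 6)⁻¹ •
        ((2 * ‖z - w‖ ^ 2) • star z + (4 * (1 - ‖z‖ ^ 2)) • star (z - w))) := by
  rw [dstarP, DiracStar_coe_of_hasFDerivAt (hasFDerivAt_pker hzw)]
  simp only [star_neg, star_add, Quaternion.star_smul]
end
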